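/- Let Z be a type with a distinguished null record ⊥, n a positive natural number, C > 0, σ > 0, δ_t ∈ (0, 1), φ : Z → EuclideanSpace ℝ (Fin k) with φ(⊥) = 0, and let 0 < τ ≤ C. Suppose every record receives the uniformly capped weight w i = τ / C. Let M map D to the product Gaussian measure on Fin k → ℝ with mean vector f_w(D) = (1/n) · Σ_i w i • clip(φ(D i), C) and per-coordinate variance σ². Then: (a) for every dataset D and index i, ‖f_w(D) − f_w(D^(−i))‖₂ ≤ τ/n; and (b) setting ε' = (τ / (n · σ)) · √(2 · log(1.25 / δ_t)) and assuming ε' < 1, for every pair of datasets D, D' differing by replacing one coordinate with ⊥ (in either direction) and every measurable S ⊆ (Fin k → ℝ), (M D) S ≤ exp(ε') · (M D') S + δ_t; in particular every record i satisfies the per-instance bound (ε', δ_t) on every dataset D. -/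

import Mathlib

open MeasureTheory ProbabilityTheory

/-- ℓ₂ clipping of `u` to norm at most `C`: `clip u C = min(1, C/‖u‖) • u`
(so `clip 0 C = 0`, matching the convention `clip(0,C)=0` since `C/0 = 0` in Lean). -/
noncomputable def clip {k : ℕ} (u : EuclideanSpace ℝ (Fin k)) (C : ℝ) :
    EuclideanSpace ℝ (Fin k) :=
  (min 1 (C / ‖u‖)) • u

/-- Weighted clipped aggregate `f_w(D) = (1/n) Σ_i w_i • clip(φ(D_i), C)`. -/
noncomputable def fw {Z : Type*} {k n : ℕ} (φ : Z → EuclideanSpace ℝ (Fin k)) (C : ℝ)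
    (w : Fin n → ℝ) (D : Fin n → Z) : EuclideanSpace ℝ (Fin k) :=
  (1 / (n : ℝ)) • ∑ i, w i • clip (φ (D i)) C

open scoped ENNReal NNReal

lemma aux_half : gaussianReal 0 1 (Set.Ioi (0:ℝ)) ≤ ENNReal.ofReal (1/2) := by
  have h1 : gaussianReal 0 1 (Set.Ioi (0:ℝ)) = gaussianReal 0 1 (Set.Iio (0:ℝ)) := by
    have h := gaussianReal_map_neg (μ := 0) (v := 1)
    rw [neg_zero] at h
    conv_lhs => rw [← h]
    rw [Measure.map_apply (by fun_prop) measurableSet_Ioi]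
    congr 1
    ext x; simp
  have h2 : gaussianReal 0 1 (Set.Ioi (0:ℝ)) + gaussianReal 0 1 (Set.Iio (0:ℝ)) ≤ 1 := by
    rw [← measure_union _ measurableSet_Iio]
    · exact prob_le_one
    · rw [Set.disjoint_left]
      intro x hx hx'
      simp only [Set.mem_Ioi, Set.mem_Iio] at hx hx'
      linarith
  rw [← h1] at h2
  have hf : gaussianReal 0 1 (Set.Ioi (0:ℝ)) ≠ ⊤ := measure_ne_top _ _
  rw [← ENNReal.ofReal_toReal hf]
  apply ENNReal.ofReal_le_ofReal
  have := ENNReal.toReal_mono (by simp) h2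
  rw [ENNReal.toReal_add hf hf] at this
  simp at this ⊢
  linarith

lemma aux_tail (t : ℝ) (ht : 0 ≤ t) :
    gaussianReal 0 1 (Set.Ioi t) ≤ ENNReal.ofReal (Real.exp (-t^2/2) * (1/2)) := by
  have h1 : gaussianReal 0 1 (Set.Ioi t) = gaussianReal (0 - t) 1 (Set.Ioi 0) := by
    rw [← gaussianReal_map_sub_const, Measure.map_apply (by fun_prop) measurableSet_Ioi]
    congr 1
    ext x; simp
  rw [h1, gaussianReal_apply _ one_ne_zero, ENNReal.ofReal_mul (Real.exp_pos _).le]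
  refine le_trans ?_ (mul_le_mul_right aux_half _)
  rw [gaussianReal_apply _ one_ne_zero, ← lintegral_const_mul _ (by fun_prop)]
  apply setLIntegral_mono (by fun_prop)
  intro y hy
  rw [gaussianPDF, gaussianPDF, ← ENNReal.ofReal_mul (Real.exp_pos _).le]
  apply ENNReal.ofReal_le_ofReal
  simp only [gaussianPDFReal]
  rw [mul_left_comm, ← Real.exp_add]
  gcongr
  have : 0 ≤ t * y := mul_nonneg ht (le_of_lt hy)
  simp
  nlinarith

lemma aux_neg (t : ℝ) (ht : t ≤ 0) :
    gaussianReal 0 1 (Set.Ioi t) ≤ ENNReal.ofReal (1/2 - t) := by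
  have h1 : Set.Ioi t = Set.Ioc t 0 ∪ Set.Ioi 0 := (Set.Ioc_union_Ioi_eq_Ioi ht).symm
  have h2 : gaussianReal 0 1 (Set.Ioc t 0) ≤ ENNReal.ofReal (-t) := by
    rw [gaussianReal_apply _ one_ne_zero]
    calc _ ≤ ∫⁻ x in Set.Ioc t 0, 1 := by
          apply lintegral_mono
          intro x
          rw [gaussianPDF, ← ENNReal.ofReal_one]
          apply ENNReal.ofReal_le_ofReal
          simp only [gaussianPDFReal]
          apply mul_le_one₀
          · apply inv_le_one_of_one_le₀
            rw [Real.one_le_sqrt]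
            simp
            nlinarith [Real.pi_gt_three]
          · positivity
          · rw [Real.exp_le_one_iff]
            simp
            nlinarith [sq_nonneg x]
      _ = _ := by simp
  rw [h1]
  refine (measure_union_le _ _).trans ((add_le_add h2 aux_half).trans ?_)
  rw [← ENNReal.ofReal_add (by linarith) (by norm_num)]
  apply ENNReal.ofReal_le_ofReal
  linarith

lemma aux_law {k : ℕ} (x c : Fin k → ℝ) (v : ℝ≥0) (hc : ∑ j, c j ^ 2 * v = 1) :
    (Measure.pi (fun j => gaussianReal (x j) v)).map (fun z => ∑ j, c j * (z j - x j))
      = gaussianReal 0 1 := by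
  set P := Measure.pi (fun j => gaussianReal (x j) v)
  have hl : ∀ j, HasLaw (fun z : Fin k → ℝ => c j * (z j - x j))
      (gaussianReal 0 (.mk (c j ^ 2) (sq_nonneg _) * v)) P := by
    intro j
    have h0 : HasLaw (fun z : Fin k → ℝ => z j) (gaussianReal (x j) v) P :=
      ⟨(measurable_pi_apply j).aemeasurable, (measurePreserving_eval _ j).map_eq⟩
    have := gaussianReal_const_mul (gaussianReal_sub_const h0 (x j)) (c j)
    simpa using this
  have hind : iIndepFun (fun j (z : Fin k → ℝ) => c j * (z j - x j)) P :=
    iIndepFun_pi (X := fun j (u : ℝ) => c j * (u - x j)) (fun j => by fun_prop)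
  have hmem : ∀ j, MemLp (fun z : Fin k → ℝ => c j * (z j - x j)) 2 P := fun j =>
    (hl j).hasGaussianLaw.memLp_two
  have hG := iIndepFun.hasGaussianLaw_fun_sum (fun j => (hl j).hasGaussianLaw) hind
  rw [hG.map_eq_gaussianReal]
  have hm : ∀ j, ∫ z, c j * (z j - x j) ∂P = 0 := by
    intro j
    have := (hl j).integral_eq
    simpa using this
  have hv : ∀ j, Var[fun z : Fin k → ℝ => c j * (z j - x j); P] = c j ^ 2 * v := by
    intro j
    have := (hl j).variance_eq
    simpa using this
  congr 1
  · rw [integral_finsetSum _ (fun j _ => (hmem j).integrable (by norm_num))]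
    simp [hm]
  · have e : (fun z : Fin k → ℝ => ∑ j, c j * (z j - x j))
        = ∑ j, (fun z : Fin k → ℝ => c j * (z j - x j)) := by
      ext z; simp
    rw [e, IndepFun.variance_sum (fun j _ => hmem j) (fun i _ j _ hij => hind.indepFun hij)]
    simp [hv, hc]

lemma aux_density1 (x y : ℝ) (v : ℝ≥0) (hv : v ≠ 0) :
    gaussianReal x v = (gaussianReal y v).withDensity
      (fun z => ENNReal.ofReal (Real.exp ((x - y) * (2 * z - x - y) / (2 * v)))) := by
  rw [gaussianReal_of_var_ne_zero _ hv, gaussianReal_of_var_ne_zero _ hv,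
    ← withDensity_mul _ (by fun_prop) (by fun_prop)]
  congr 1
  ext z
  simp only [Pi.mul_apply, gaussianPDF]
  rw [← ENNReal.ofReal_mul (gaussianPDFReal_nonneg _ _ _)]
  congr 1
  simp only [gaussianPDFReal]
  rw [mul_assoc _ (Real.exp _) (Real.exp _), ← Real.exp_add]
  congr 2
  have : (v : ℝ) ≠ 0 := by exact_mod_cast hv
  field_simp
  ring

lemma aux_density {k : ℕ} (x y : Fin k → ℝ) (v : ℝ≥0) (hv : v ≠ 0) :
    Measure.pi (fun j => gaussianReal (x j) v)
      = (Measure.pi (fun j => gaussianReal (y j) v)).withDensity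
      (fun z => ENNReal.ofReal (Real.exp
        (∑ j, (x j - y j) * (2 * z j - x j - y j) / (2 * v)))) := by
  apply Measure.pi_eq
  intro s hs
  rw [withDensity_apply _ (MeasurableSet.univ_pi hs), ← lintegral_indicator (MeasurableSet.univ_pi hs)]
  have : ∀ z : Fin k → ℝ, (Set.univ.pi s).indicator (fun z => ENNReal.ofReal (Real.exp
        (∑ j, (x j - y j) * (2 * z j - x j - y j) / (2 * v)))) z
      = ∏ j, (s j).indicator (fun u => ENNReal.ofReal (Real.exp
        ((x j - y j) * (2 * u - x j - y j) / (2 * v)))) (z j) := by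
    intro z
    by_cases hz : z ∈ Set.univ.pi s
    · rw [Set.indicator_of_mem hz, Real.exp_sum,
        ENNReal.ofReal_prod_of_nonneg (fun _ _ => (Real.exp_pos _).le)]
      refine Finset.prod_congr rfl fun j _ => ?_
      rw [Set.indicator_of_mem (hz j (Set.mem_univ j))]
    · rw [Set.indicator_of_notMem hz]
      simp only [Set.mem_pi, Set.mem_univ, true_implies, not_forall] at hz
      obtain ⟨j, hj⟩ := hz
      symm
      apply Finset.prod_eq_zero (Finset.mem_univ j)
      rw [Set.indicator_of_notMem hj]
  simp_rw [this]
  have hmeas : ∀ j, Measurable ((s j).indicator (fun u : ℝ => ENNReal.ofReal (Real.exp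
        ((x j - y j) * (2 * u - x j - y j) / (2 * v))))) := fun j =>
    Measurable.indicator (by fun_prop) (hs j)
  rw [lintegral_prod_eq_prod_lintegral_of_indepFun Finset.univ
    (fun j (z : Fin k → ℝ) => (s j).indicator (fun u => ENNReal.ofReal (Real.exp
        ((x j - y j) * (2 * u - x j - y j) / (2 * v)))) (z j))
    (iIndepFun_pi (fun j => (hmeas j).aemeasurable))
    (fun j => (hmeas j).comp (measurable_pi_apply j))]
  refine Finset.prod_congr rfl fun j _ => ?_
  rw [(measurePreserving_eval (fun j => gaussianReal (y j) v) j).lintegral_comp (hmeas j),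
    lintegral_indicator (hs j), aux_density1 (x j) (y j) v hv, withDensity_apply _ (hs j)]

lemma aux_bound (c ε δ b t : ℝ) (hδ0 : 0 < δ) (hδ1 : δ < 1)
    (hc : c = Real.sqrt (2 * Real.log (1.25 / δ)))
    (a : ℝ) (hε : ε = a * c) (hε1 : ε < 1) (hb : 0 < b) (hba : b ≤ a)
    (ht : t = ε / b - b / 2) :
    gaussianReal 0 1 (Set.Ioi t) ≤ ENNReal.ofReal δ := by
  have hlog : 1/5 ≤ Real.log (1.25/δ) := by
    have h1 := Real.one_sub_inv_le_log_of_pos (x := 1.25/δ) (by positivity)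
    have h2 : (1.25/δ)⁻¹ = δ * (4/5) := by rw [inv_div]; ring
    rw [h2] at h1
    linarith
  have hc2 : c^2 = 2 * Real.log (1.25 / δ) := by
    rw [hc, Real.sq_sqrt (by linarith)]
  have hc0 : 0 ≤ c := hc ▸ Real.sqrt_nonneg _
  have hcp : 3/5 ≤ c := by nlinarith
  have hδ : δ = 1.25 * Real.exp (-c^2/2) := by
    rw [hc2, show -(2 * Real.log (1.25/δ))/2 = -Real.log (1.25/δ) by ring, Real.exp_neg,
      Real.exp_log (by positivity)]
    field_simp
  have ha : 0 < a := hb.trans_le hba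
  have h1 : c ≤ ε / b := by
    rw [le_div_iff₀ hb, hε]; nlinarith
  have ht1 : c - a / 2 ≤ t := by rw [ht]; linarith
  have hac : a * c < 1 := hε ▸ hε1
  rcases le_total 0 (c - a/2) with h | h
  · refine (aux_tail t (h.trans ht1)).trans (ENNReal.ofReal_le_ofReal ?_)
    have h3 : c^2 - 1 ≤ t^2 := by nlinarith
    calc Real.exp (-t^2/2) * (1/2) ≤ Real.exp (1/2 + -c^2/2) * (1/2) := by
          gcongr; linarith
      _ = Real.exp (1/2) * Real.exp (-c^2/2) * (1/2) := by rw [Real.exp_add]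
      _ ≤ 2 * Real.exp (-c^2/2) * (1/2) := by
          gcongr
          have : Real.exp (1/2) ^ 2 = Real.exp 1 := by
            rw [← Real.exp_nat_mul]; norm_num
          have := Real.exp_one_lt_d9
          nlinarith [Real.exp_pos (1/2)]
      _ ≤ δ := by rw [hδ]; nlinarith [Real.exp_pos (-c^2/2)]
  · have hcc : c^2 ≤ 1/2 := by nlinarith
    have hδ' : 0.9 ≤ δ := by
      have := Real.add_one_le_exp (-c^2/2)
      rw [hδ]; linarith
    have hta : -(2/5) ≤ t := by
      have : a < 5/3 := by nlinarith
      linarith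
    rcases le_total t 0 with h0 | h0
    · refine (aux_neg t h0).trans (ENNReal.ofReal_le_ofReal ?_)
      linarith
    · refine (aux_tail t h0).trans (ENNReal.ofReal_le_ofReal ?_)
      have : Real.exp (-t^2/2) ≤ 1 := by
        rw [Real.exp_le_one_iff]; nlinarith
      linarith

lemma aux_mech {k : ℕ} (x y : EuclideanSpace ℝ (Fin k)) (σ δ Δ : ℝ) (hσ : 0 < σ)
    (hδ0 : 0 < δ) (hδ1 : δ < 1) (hxy : ‖x - y‖ ≤ Δ)
    (hε1 : Δ / σ * Real.sqrt (2 * Real.log (1.25 / δ)) < 1)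
    (S : Set (Fin k → ℝ)) (hS : MeasurableSet S) :
    Measure.pi (fun j => gaussianReal (x j) ⟨σ ^ 2, sq_nonneg σ⟩) S ≤
      ENNReal.ofReal (Real.exp (Δ / σ * Real.sqrt (2 * Real.log (1.25 / δ)))) *
        Measure.pi (fun j => gaussianReal (y j) ⟨σ ^ 2, sq_nonneg σ⟩) S + ENNReal.ofReal δ := by
  set ε := Δ / σ * Real.sqrt (2 * Real.log (1.25 / δ)) with hε
  set v : ℝ≥0 := ⟨σ ^ 2, sq_nonneg σ⟩ with hvdef
  have hvr : (v : ℝ) = σ ^ 2 := rfl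
  have hv : v ≠ 0 := by
    intro h
    have : (v : ℝ) = 0 := by rw [h]; rfl
    rw [hvr] at this
    exact absurd this (by positivity)
  have hΔ : 0 ≤ Δ := (norm_nonneg _).trans hxy
  have hε0 : 0 ≤ ε := by positivity
  rcases (norm_nonneg (x - y)).eq_or_lt with h0 | h0
  · have : x = y := by
      rw [← sub_eq_zero, ← norm_eq_zero]; exact h0.symm
    subst this
    refine le_trans ?_ le_self_add
    refine le_mul_of_one_le_left zero_le ?_
    rw [ENNReal.one_le_ofReal]
    exact Real.one_le_exp hε0
  set d := ‖x - y‖ with hd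
  have hdsq : ∑ j, (x j - y j)^2 = d^2 := by
    rw [hd, EuclideanSpace.real_norm_sq_eq]; simp
  set L : (Fin k → ℝ) → ℝ := fun z => ∑ j, (x j - y j) * (2 * z j - x j - y j) / (2 * v) with hL
  have hLm : Measurable L := by fun_prop
  set c : Fin k → ℝ := fun j => (x j - y j) / (σ * d) with hc
  have hLT : ∀ z, L z = (d / σ) * (∑ j, c j * (z j - x j)) + (d/σ)^2 / 2 := by
    intro z
    rw [div_pow, ← hdsq, Finset.sum_div, Finset.sum_div, Finset.mul_sum, ← Finset.sum_add_distrib, hL]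
    refine Finset.sum_congr rfl fun j _ => ?_
    simp only [hc, hvr]
    field_simp
    ring
  have hcs : ∑ j, c j ^ 2 * v = 1 := by
    simp only [hc, hvr, div_pow]
    rw [← Finset.sum_mul, ← Finset.sum_div, hdsq]
    field_simp
  have hlaw := aux_law (fun j => x j) c v hcs
  have hbad : Measure.pi (fun j => gaussianReal (x j) v) {z | ε < L z} ≤ ENNReal.ofReal δ := by
    have hset : {z | ε < L z} = (fun z : Fin k → ℝ => ∑ j, c j * (z j - x j)) ⁻¹'
        Set.Ioi (ε / (d/σ) - (d/σ) / 2) := by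
      ext z
      have hb : 0 < d / σ := by positivity
      simp only [Set.mem_ofPred_eq, Set.mem_preimage, Set.mem_Ioi, hLT z]
      rw [sub_lt_iff_lt_add, div_lt_iff₀ hb]
      ring_nf
    rw [hset, ← Measure.map_apply (by fun_prop) measurableSet_Ioi, hlaw]
    exact aux_bound _ ε δ (d/σ) _ hδ0 hδ1 rfl (Δ/σ) hε hε1 (by positivity) (by gcongr) rfl
  have hbm : MeasurableSet {z | ε < L z} := measurableSet_lt measurable_const hLm
  rw [← measure_sdiff_add_inter S hbm]
  refine add_le_add ?_ ((measure_mono Set.inter_subset_right).trans hbad)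
  rw [aux_density (fun j => x j) (fun j => y j) v hv, withDensity_apply _ (hS.diff hbm)]
  calc _ ≤ ∫⁻ z in S \ {z | ε < L z}, ENNReal.ofReal (Real.exp ε)
          ∂(Measure.pi (fun j => gaussianReal (y j) v)) := by
        apply setLIntegral_mono measurable_const
        intro z hz
        apply ENNReal.ofReal_le_ofReal
        apply Real.exp_le_exp.2
        have := hz.2
        simp only [Set.mem_ofPred_eq, not_lt] at this
        exact this
    _ ≤ _ := by
        rw [setLIntegral_const]
        gcongr
        exact Set.sdiff_subset

lemma aux_clip {k : ℕ} (u : EuclideanSpace ℝ (Fin k)) (C : ℝ) (hC : 0 < C) :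
    ‖clip u C‖ ≤ C := by
  rw [clip, norm_smul, Real.norm_of_nonneg (le_min zero_le_one (by positivity))]
  rcases (norm_nonneg u).eq_or_lt with h | h
  · rw [← h]; simpa using hC.le
  · calc _ ≤ C / ‖u‖ * ‖u‖ := by gcongr; exact min_le_right _ _
      _ = C := by field_simp

lemma aux_sens {Z : Type*} {k : ℕ} (nullz : Z) (n : ℕ) (hn : 0 < n)
    (C τ : ℝ) (hC : 0 < C) (hτ0 : 0 < τ)
    (φ : Z → EuclideanSpace ℝ (Fin k)) (hφ : φ nullz = 0)
    (w : Fin n → ℝ) (hwdef : ∀ i, w i = τ / C) (D : Fin n → Z) (i : Fin n) :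
    ‖fw φ C w D - fw φ C w (Function.update D i nullz)‖ ≤ τ / n := by
  have h : fw φ C w D - fw φ C w (Function.update D i nullz)
      = (1 / (n:ℝ)) • ((τ / C) • clip (φ (D i)) C) := by
    rw [fw, fw, ← smul_sub, ← Finset.sum_sub_distrib, Finset.sum_eq_single i]
    · simp [hφ, clip, hwdef]
    · intro j _ hj
      simp [Function.update_of_ne hj]
    · simp
  have hn' : (0:ℝ) < n := by exact_mod_cast hn
  rw [h, norm_smul, norm_smul, Real.norm_of_nonneg (by positivity),
    Real.norm_of_nonneg (by positivity)]
  calc _ ≤ 1 / (n:ℝ) * (τ / C * C) := by gcongr; exact aux_clip _ _ hC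
    _ = τ / n := by field_simp

/-- Naive uniform capping. With every weight set to `τ/C`:
(a) every record's influence on `f_w` is at most `τ/n`; (b) the Gaussian release of
`f_w(D)` with per-coordinate variance `σ²` satisfies the `(ε', δ_t)` inequality
(`ε' = (τ/(nσ))·√(2 log(1.25/δ_t)) < 1`) for all neighboring pairs — in particular,
every record satisfies the `(ε', δ_t)` per-instance bound on every dataset. -/
theorem uniform_capping_equalizes
    {Z : Type*} {k : ℕ} (nullz : Z) (n : ℕ) (hn : 0 < n)
    (C σ δt τ : ℝ) (hC : 0 < C) (hσ : 0 < σ) (hδt0 : 0 < δt) (hδt1 : δt < 1)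
    (hτ0 : 0 < τ) (hτC : τ ≤ C)
    (φ : Z → EuclideanSpace ℝ (Fin k)) (hφ : φ nullz = 0)
    (w : Fin n → ℝ) (hwdef : ∀ i, w i = τ / C)
    (hε : (τ / ((n : ℝ) * σ)) * Real.sqrt (2 * Real.log (1.25 / δt)) < 1) :
    (∀ (D : Fin n → Z) (i : Fin n),
        ‖fw φ C w D - fw φ C w (Function.update D i nullz)‖ ≤ τ / n) ∧
      (∀ D D' : Fin n → Z,
        (∃ i, D' = Function.update D i nullz ∨ D = Function.update D' i nullz) →
        ∀ S : Set (Fin k → ℝ), MeasurableSet S →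
          Measure.pi (fun j => gaussianReal (fw φ C w D j) ⟨σ ^ 2, sq_nonneg σ⟩) S ≤
            ENNReal.ofReal
                (Real.exp ((τ / ((n : ℝ) * σ)) * Real.sqrt (2 * Real.log (1.25 / δt)))) *
              Measure.pi (fun j => gaussianReal (fw φ C w D' j) ⟨σ ^ 2, sq_nonneg σ⟩) S
            + ENNReal.ofReal δt) ∧
      (∀ (D : Fin n → Z) (i : Fin n), ∀ S : Set (Fin k → ℝ), MeasurableSet S →
          Measure.pi (fun j => gaussianReal (fw φ C w D j) ⟨σ ^ 2, sq_nonneg σ⟩) S ≤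
            ENNReal.ofReal
                (Real.exp ((τ / ((n : ℝ) * σ)) * Real.sqrt (2 * Real.log (1.25 / δt)))) *
              Measure.pi (fun j =>
                gaussianReal (fw φ C w (Function.update D i nullz) j)
                  ⟨σ ^ 2, sq_nonneg σ⟩) S
            + ENNReal.ofReal δt) := by
  have hsens := aux_sens nullz n hn C τ hC hτ0 φ hφ w hwdef
  rw [← div_div] at hε ⊢
  refine ⟨hsens, ?_, ?_⟩
  · rintro D D' ⟨i, rfl | rfl⟩ S hS
    · exact aux_mech _ _ σ δt (τ / n) hσ hδt0 hδt1 (hsens D i) hε S hS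
    · refine aux_mech _ _ σ δt (τ / n) hσ hδt0 hδt1 ?_ hε S hS
      rw [norm_sub_rev]
      exact hsens D' i
  · intro D i S hS
    exact aux_mech _ _ σ δt (τ / n) hσ hδt0 hδt1 (hsens D i) hε S hS
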